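/- Characterisation of q-tameness by approximation: a persistence module V over ℝ is q-tame if and only if for every ε > 0 there exists a locally finite persistence module W over ℝ such that V and W are ε-interleaved. -/

import Mathlib

attribute [local instance] Classical.propDecidable

structure PersMod (k : Type) [Field k] (T : Type) [Preorder T] where
  space : T → Type
  [addCommGroup : ∀ t, AddCommGroup (space t)]
  [module : ∀ t, Module k (space t)]
  map : ∀ s t : T, s ≤ t → space s →ₗ[k] space t
  map_id : ∀ t, map t t le_rfl = LinearMap.id
  map_comp : ∀ r s t (h1 : r ≤ s) (h2 : s ≤ t),
    (map s t h2).comp (map r s h1) = map r t (h1.trans h2)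

attribute [instance] PersMod.addCommGroup PersMod.module

def PersIso {k : Type} [Field k] {T : Type} [Preorder T] (U V : PersMod k T) : Prop :=
  ∃ e : ∀ t, U.space t ≃ₗ[k] V.space t,
    ∀ s t (h : s ≤ t),
      (e t).toLinearMap.comp (U.map s t h) = (V.map s t h).comp (e s).toLinearMap

def IsIntervalSet {T : Type} [Preorder T] (J : Set T) : Prop :=
  J.Nonempty ∧ ∀ ⦃r s t : T⦄, r ∈ J → t ∈ J → r ≤ s → s ≤ t → s ∈ J

noncomputable def intervalModule (k : Type) [Field k] (T : Type) [Preorder T]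
    (J : Set T) (hJ : IsIntervalSet J) : PersMod k T where
  space t := PLift (t ∈ J) → k
  addCommGroup := fun _ => inferInstance
  module := fun _ => inferInstance
  map s t _ :=
    { toFun := fun f _ => if hs : s ∈ J then f ⟨hs⟩ else 0
      map_add' := fun f g => by
        funext ht; by_cases hs : s ∈ J <;> simp [hs]
      map_smul' := fun c f => by
        funext ht; by_cases hs : s ∈ J <;> simp [hs] }
  map_id t := by
    refine LinearMap.ext fun f => funext fun ht => ?_
    show (if hs : t ∈ J then f ⟨hs⟩ else 0) = f ht
    rw [dif_pos ht.down]
  map_comp r s t h1 h2 := by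
    refine LinearMap.ext fun f => funext fun ht => ?_
    show (if hs : s ∈ J then (if hr : r ∈ J then f ⟨hr⟩ else 0) else 0)
        = (if hr : r ∈ J then f ⟨hr⟩ else 0)
    by_cases hr : r ∈ J
    · have hs : s ∈ J := hJ.2 hr ht.down h1 h2
      simp [hr, hs]
    · by_cases hs : s ∈ J <;> simp [hr, hs]

noncomputable def dsum {k : Type} [Field k] {T : Type} [Preorder T] {L : Type}
    (V : L → PersMod k T) : PersMod k T where
  space t := DFinsupp (fun ℓ => (V ℓ).space t)
  addCommGroup := fun _ => inferInstance
  module := fun _ => inferInstance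
  map s t h := DFinsupp.mapRange.linearMap (fun ℓ => (V ℓ).map s t h)
  map_id t := by
    show DFinsupp.mapRange.linearMap (fun ℓ => (V ℓ).map t t le_rfl) = LinearMap.id
    have : (fun ℓ => (V ℓ).map t t le_rfl)
        = fun ℓ => (LinearMap.id : (V ℓ).space t →ₗ[k] (V ℓ).space t) :=
      funext fun ℓ => (V ℓ).map_id t
    rw [this]
    exact DFinsupp.mapRange.linearMap_id
  map_comp r s t h1 h2 := by
    show (DFinsupp.mapRange.linearMap (fun ℓ => (V ℓ).map s t h2)).comp
        (DFinsupp.mapRange.linearMap (fun ℓ => (V ℓ).map r s h1))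
      = DFinsupp.mapRange.linearMap (fun ℓ => (V ℓ).map r t (h1.trans h2))
    rw [← DFinsupp.mapRange.linearMap_comp]
    congr 1
    funext ℓ
    exact (V ℓ).map_comp r s t h1 h2

open scoped ENNReal

section Dim

noncomputable def edim (k : Type) [Field k] (M : Type) [AddCommGroup M] [Module k M] : ℕ∞ :=
  Cardinal.toENat (Module.rank k M)

noncomputable def erank {k : Type} [Field k] {M N : Type} [AddCommGroup M] [Module k M]
    [AddCommGroup N] [Module k N] (f : M →ₗ[k] N) : ℕ∞ :=
  edim k (LinearMap.range f)

noncomputable def ecard (S : Type) : ℕ∞ := Cardinal.toENat (Cardinal.mk S)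

end Dim

section Matchings

noncomputable def eDiff (x y : EReal) : ℝ≥0∞ :=
  if x = y then 0
  else if x = ⊤ ∨ x = ⊥ ∨ y = ⊤ ∨ y = ⊥ then ⊤
  else ENNReal.ofReal |x.toReal - y.toReal|

noncomputable def dPt (α β : EReal × EReal) : ℝ≥0∞ :=
  max (eDiff α.1 β.1) (eDiff α.2 β.2)

noncomputable def diagDist (α : EReal × EReal) : ℝ≥0∞ :=
  if α.1 = ⊥ ∨ α.2 = ⊤ then ⊤ else ENNReal.ofReal ((α.2.toReal - α.1.toReal) / 2)

def IsMatching {α β : Type} (M : Set (α × β)) : Prop :=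
  (∀ a b b', (a, b) ∈ M → (a, b') ∈ M → b = b') ∧
  (∀ a a' b, (a, b) ∈ M → (a', b) ∈ M → a = a')

def IsDeltaMatching {α β : Type} (A : α → EReal × EReal) (B : β → EReal × EReal)
    (δ : ℝ≥0∞) : Prop :=
  ∃ M : Set (α × β), IsMatching M ∧
    (∀ p ∈ M, dPt (A p.1) (B p.2) ≤ δ) ∧
    (∀ a, (∀ b, (a, b) ∉ M) → diagDist (A a) ≤ δ) ∧
    (∀ b, (∀ a, (a, b) ∉ M) → diagDist (B b) ≤ δ)

noncomputable def dBottle {α β : Type} (A : α → EReal × EReal) (B : β → EReal × EReal) : ℝ≥0∞ :=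
  sInf {d : ℝ≥0∞ | ∃ δ : ℝ, 0 ≤ δ ∧ IsDeltaMatching A B (ENNReal.ofReal δ) ∧ d = ENNReal.ofReal δ}

end Matchings

section Measure

noncomputable def persIm {k : Type} [Field k] (V : PersMod k ℝ) (a : EReal) (c : ℝ) :
    Submodule k (V.space c) :=
  if h : ∃ a' : ℝ, a = (a' : EReal) ∧ a' ≤ c then
    LinearMap.range (V.map h.choose c h.choose_spec.2)
  else ⊥

noncomputable def persKer {k : Type} [Field k] (V : PersMod k ℝ) (c : ℝ) (d : EReal) :
    Submodule k (V.space c) :=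
  if h : ∃ d' : ℝ, d = (d' : EReal) ∧ c ≤ d' then
    LinearMap.ker (V.map c h.choose h.choose_spec.2)
  else ⊤

noncomputable def persMeasure {k : Type} [Field k] (V : PersMod k ℝ)
    (a : EReal) (b c : ℝ) (d : EReal) : ℕ∞ :=
  edim k
    (↥(persIm V (b : EReal) c ⊓ persKer V c d) ⧸
      Submodule.comap (persIm V (b : EReal) c ⊓ persKer V c d).subtype
        (persIm V a c ⊓ persKer V c d))

end Measure

section Interleaving

def Interleaved (k : Type) [Field k] (U V : PersMod k ℝ) (δ : ℝ) : Prop :=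
  ∃ (φ : ∀ t : ℝ, U.space t →ₗ[k] V.space (t + δ))
    (ψ : ∀ t : ℝ, V.space t →ₗ[k] U.space (t + δ)),
    (∀ s t (h : s ≤ t),
      (φ t).comp (U.map s t h) = (V.map (s + δ) (t + δ) (by linarith)).comp (φ s)) ∧
    (∀ s t (h : s ≤ t),
      (ψ t).comp (V.map s t h) = (U.map (s + δ) (t + δ) (by linarith)).comp (ψ s)) ∧
    (∀ t (h : t ≤ t + δ + δ), (ψ (t + δ)).comp (φ t) = U.map t (t + δ + δ) h) ∧
    (∀ t (h : t ≤ t + δ + δ), (φ (t + δ)).comp (ψ t) = V.map t (t + δ + δ) h)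

noncomputable def dInter (k : Type) [Field k] (U V : PersMod k ℝ) : ℝ≥0∞ :=
  sInf {d : ℝ≥0∞ | ∃ δ : ℝ, 0 ≤ δ ∧ Interleaved k U V δ ∧ d = ENNReal.ofReal δ}

def QTame (k : Type) [Field k] (V : PersMod k ℝ) : Prop :=
  ∀ s t : ℝ, ∀ h : s < t, erank (V.map s t h.le) ≠ ⊤

def LocFinitePM (k : Type) [Field k] (W : PersMod k ℝ) : Prop :=
  ∃ (L : Type) (J : L → Set ℝ) (hJ : ∀ ℓ, IsIntervalSet (J ℓ)),
    PersIso W (dsum fun ℓ => intervalModule k ℝ (J ℓ) (hJ ℓ)) ∧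
    ∀ S : Set ℝ, Bornology.IsBounded S → {ℓ : L | (J ℓ ∩ S).Nonempty}.Finite

noncomputable def zeroPers (k : Type) [Field k] : PersMod k ℝ where
  space _ := PUnit
  addCommGroup := fun _ => inferInstance
  module := fun _ => inferInstance
  map _ _ _ := 0
  map_id t := LinearMap.ext fun x => Subsingleton.elim _ _
  map_comp r s t h1 h2 := LinearMap.ext fun x => Subsingleton.elim _ _

noncomputable def smoothing {k : Type} [Field k] (V : PersMod k ℝ) (ε : ℝ) (hε : 0 < ε) :
    PersMod k ℝ where
  space t := LinearMap.range (V.map (t - ε) (t + ε) (by linarith))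
  addCommGroup := fun _ => inferInstance
  module := fun _ => inferInstance
  map s t h := LinearMap.restrict (V.map (s + ε) (t + ε) (by linarith))
    (p := LinearMap.range (V.map (s - ε) (s + ε) (by linarith)))
    (q := LinearMap.range (V.map (t - ε) (t + ε) (by linarith)))
    (by
      rintro x ⟨y, rfl⟩
      refine ⟨V.map (s - ε) (t - ε) (by linarith) y, ?_⟩
      have h1 := LinearMap.congr_fun
        (V.map_comp (s - ε) (t - ε) (t + ε) (by linarith) (by linarith)) y
      have h2 := LinearMap.congr_fun
        (V.map_comp (s - ε) (s + ε) (t + ε) (by linarith) (by linarith)) y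
      simp only [LinearMap.comp_apply] at h1 h2
      rw [h1, h2])
  map_id t := by
    refine LinearMap.ext fun x => Subtype.ext ?_
    have := LinearMap.congr_fun (V.map_id (t + ε)) x.1
    simpa [LinearMap.restrict_apply] using this
  map_comp r s t h1 h2 := by
    refine LinearMap.ext fun x => Subtype.ext ?_
    have := LinearMap.congr_fun
      (V.map_comp (r + ε) (s + ε) (t + ε) (by linarith) (by linarith)) x.1
    simpa [LinearMap.restrict_apply] using this

end Interleaving

section Webb

def webbSubmodule (k : Type) [Field k] (t : ℤ) : Submodule k (ℕ → k) where
  carrier := {x | ∀ i : ℕ, (i : ℤ) < -t → x i = 0}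
  add_mem' := by
    intro x y hx hy i hi
    simp [Pi.add_apply, hx i hi, hy i hi]
  zero_mem' := by
    intro i hi
    rfl
  smul_mem' := by
    intro c x hx i hi
    simp [Pi.smul_apply, hx i hi]

noncomputable def webbModule (k : Type) [Field k] : PersMod k ↥{n : ℤ | n ≤ 0} where
  space t := ↥(webbSubmodule k t.1)
  addCommGroup := fun _ => inferInstance
  module := fun _ => inferInstance
  map s t h := Submodule.inclusion (by
    intro x hx
    have hx' : ∀ i : ℕ, (i : ℤ) < -s.1 → x i = 0 := hx
    intro i hi
    exact hx' i (lt_of_lt_of_le hi (neg_le_neg h)))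
  map_id t := LinearMap.ext fun x => rfl
  map_comp r s t h1 h2 := LinearMap.ext fun x => rfl

end Webb

section Decorated

/-- `decMem t x` : the real number `t` belongs to the interval described by the
decorated pair `x = ((p, εp), (q, εq))`, where the decoration `false` means `⁻`
and `true` means `⁺`. -/
def decMem (t : ℝ) (x : (EReal × Bool) × (EReal × Bool)) : Prop :=
  (x.1.1 < (t : EReal) ∨ (x.1.1 = (t : EReal) ∧ x.1.2 = false)) ∧
  ((t : EReal) < x.2.1 ∨ ((t : EReal) = x.2.1 ∧ x.2.2 = true))

/-- A valid decorated pair: the left coordinate is `p⁻`/`p⁺` for a real `p` or `−∞⁺`,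
the right coordinate is `q⁻`/`q⁺` for a real `q` or `+∞⁻`, and the corresponding
interval is nonempty (i.e. `p* < q*`). -/
def ValidDec (x : (EReal × Bool) × (EReal × Bool)) : Prop :=
  (x.1.1 = ⊥ → x.1.2 = true) ∧ x.1.1 ≠ ⊤ ∧ (x.2.1 = ⊤ → x.2.2 = false) ∧ x.2.1 ≠ ⊥ ∧
  {t : ℝ | decMem t x}.Nonempty

/-- The decorated pair `x` belongs to the rectangle `[a,b] × [c,d]`, i.e.
`[b,c] ⊆ ⟨p*,q*⟩ ⊆ (a,d)`. -/
def decInRect (x : (EReal × Bool) × (EReal × Bool)) (a : EReal) (b c : ℝ) (d : EReal) : Prop :=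
  (∀ t ∈ Set.Icc b c, decMem t x) ∧
  (∀ t : ℝ, decMem t x → a < (t : EReal) ∧ (t : EReal) < d)

/-- `Dgm` is (a labelling of) the decorated persistence diagram of `V`. -/
def IsDgmOf {k : Type} [Field k] (V : PersMod k ℝ) {ι : Type}
    (Dgm : ι → (EReal × Bool) × (EReal × Bool)) : Prop :=
  (∀ i, ValidDec (Dgm i)) ∧
  ∀ (a : EReal) (b c : ℝ) (d : EReal), a < (b : EReal) → b ≤ c → (c : EReal) < d →
    persMeasure V a b c d = ecard {i : ι // decInRect (Dgm i) a b c d}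

end Decorated

section RMeasure

/-- `[a,b] × [c,d]` is a (nondegenerate) rectangle contained in `D`. -/
def RectIn (D : Set (ℝ × ℝ)) (a b c d : ℝ) : Prop :=
  a < b ∧ c < d ∧ Set.Icc a b ×ˢ Set.Icc c d ⊆ D

/-- An r-measure on `D`: additivity under horizontal and vertical splitting. -/
def IsRMeasure (D : Set (ℝ × ℝ)) (μ : ℝ → ℝ → ℝ → ℝ → ℕ∞) : Prop :=
  (∀ a p b c d, a < p → p < b → RectIn D a b c d → μ a b c d = μ a p c d + μ p b c d) ∧
  (∀ a b c q d, c < q → q < d → RectIn D a b c d → μ a b c d = μ a b c q + μ a b q d)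

/-- Membership of a decorated point of the plane (`Bool` decoration: `true` = `⁺`,
`false` = `⁻`) in the closed rectangle `[a,b] × [c,d]`. -/
def dptMem (x : (ℝ × Bool) × (ℝ × Bool)) (a b c d : ℝ) : Prop :=
  a ≤ x.1.1 ∧ x.1.1 ≤ b ∧ c ≤ x.2.1 ∧ x.2.1 ≤ d ∧
  (x.1.1 = a → x.1.2 = true) ∧ (x.1.1 = b → x.1.2 = false) ∧
  (x.2.1 = c → x.2.2 = true) ∧ (x.2.1 = d → x.2.2 = false)

/-- The r-interior `D•` of `D`: decorated points contained in some rectangle of `D`. -/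
def rInt (D : Set (ℝ × ℝ)) : Set ((ℝ × Bool) × (ℝ × Bool)) :=
  {x | ∃ a b c d, RectIn D a b c d ∧ dptMem x a b c d}

/-- The number of decorated points, counted with multiplicity `m`, lying in the
rectangle `[a,b] × [c,d]`. -/
noncomputable def dcount (m : (ℝ × Bool) × (ℝ × Bool) → ℕ) (a b c d : ℝ) : ℕ∞ :=
  ecard (Σ x : {x : (ℝ × Bool) × (ℝ × Bool) // dptMem x a b c d}, Fin (m x.1))

end RMeasure


theorem PersMod.mm {k : Type} [Field k] {T : Type} [Preorder T] (X : PersMod k T) {r s t : T}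
    (h1 : r ≤ s) (h2 : s ≤ t) (x : X.space r) :
    X.map s t h2 (X.map r s h1 x) = X.map r t (h1.trans h2) x :=
  LinearMap.congr_fun (X.map_comp r s t h1 h2) x

theorem PersMod.mid {k : Type} [Field k] {T : Type} [Preorder T] (X : PersMod k T) {t : T}
    (h : t ≤ t) (x : X.space t) : X.map t t h x = x :=
  LinearMap.congr_fun (X.map_id t) x

/-- stabilisation of the images coming from the left -/
theorem stab_left {k : Type} [Field k] (X : PersMod k ℤ)
    (fin : ∀ n, Module.Finite k (X.space n)) (n0 : ℤ) (A : ℕ → Prop) (i : ℕ) (hi : A i) :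
    ∃ j, ∃ h : i ≤ j, A j ∧ ∀ j' (h' : i ≤ j'), A j' →
      LinearMap.range (X.map (n0 - j) (n0 - i) (by omega)) ≤
        LinearMap.range (X.map (n0 - j') (n0 - i) (by omega)) := by
  have := fin (n0 - i)
  let S : Set (Submodule k (X.space (n0 - i))) :=
    {p | ∃ j, ∃ h : i ≤ j, A j ∧ p = LinearMap.range (X.map (n0 - j) (n0 - i) (by omega))}
  have hS : S.Nonempty := ⟨_, i, le_rfl, hi, rfl⟩
  have wf : WellFounded ((· < ·) : Submodule k (X.space (n0 - i)) → _ → Prop) := wellFounded_lt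
  obtain ⟨p, ⟨j, hij, hA, rfl⟩, hmin⟩ := wf.has_min S hS
  refine ⟨j, hij, hA, fun j' hj' hA' => ?_⟩
  rcases le_total j j' with h | h
  · have hle : LinearMap.range (X.map (n0 - j') (n0 - i) (by omega)) ≤
        LinearMap.range (X.map (n0 - j) (n0 - i) (by omega)) := by
      rintro _ ⟨z, rfl⟩
      exact ⟨X.map (n0 - j') (n0 - j) (by omega) z, X.mm _ _ _⟩
    have := hmin _ ⟨j', hj', hA', rfl⟩
    by_contra hc
    exact this (lt_of_le_not_ge hle hc)
  · rintro _ ⟨z, rfl⟩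
    exact ⟨X.map (n0 - j) (n0 - j') (by omega) z, X.mm _ _ _⟩

/-- a sequence of lifts going to the left -/
theorem exists_lift_seq {k : Type} [Field k] (X : PersMod k ℤ)
    (fin : ∀ n, Module.Finite k (X.space n)) (n0 : ℤ) (v : X.space n0) (hv : v ≠ 0) :
    ∃ g : ∀ j : ℕ, X.space (n0 - j),
      (X.map (n0 - (0 : ℕ)) n0 (by simp) (g 0) ≠ 0) ∧
      (∀ j : ℕ, g j ≠ 0 → ∀ i (h : i ≤ j), X.map (n0 - j) (n0 - i) (by omega) (g j) = g i) ∧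
      (∀ j : ℕ, g j = 0 → X.map (n0 - j) n0 (by omega) = 0) := by
  let A : ℕ → Prop := fun j => X.map (n0 - j) n0 (by omega) ≠ 0
  have hA : ∀ i j, i ≤ j → A j → A i := by
    intro i j hij hj h0
    apply hj
    ext z
    rw [← X.mm (s := n0 - i) (by omega) (by omega), h0]
    rfl
  have hA0 : A 0 := by
    intro h0
    apply hv
    have := LinearMap.congr_fun h0 (X.map n0 (n0 - (0 : ℕ)) (by simp) v)
    rw [X.mm, X.mid] at this
    simpa using this
  let P : ∀ i : ℕ, X.space (n0 - i) → Prop := fun i y =>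
    ∀ j (h : i ≤ j), A j → y ∈ LinearMap.range (X.map (n0 - j) (n0 - i) (by omega))
  have start : ∃ y, P 0 y ∧ X.map (n0 - (0 : ℕ)) n0 (by simp) y ≠ 0 := by
    obtain ⟨j, hj, hAj, hmin⟩ := stab_left X fin n0 A 0 hA0
    obtain ⟨z, hz⟩ : ∃ z, X.map (n0 - j) n0 (by omega) z ≠ 0 := by
      by_contra hc
      push Not at hc
      exact hAj (LinearMap.ext hc)
    refine ⟨X.map (n0 - j) (n0 - (0 : ℕ)) (by omega) z, fun j' hj' hA' => ?_, ?_⟩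
    · exact hmin j' hj' hA' ⟨z, rfl⟩
    · rwa [X.mm]
  have step : ∀ (i : ℕ) (y : X.space (n0 - i)), A (i + 1) → P i y →
      ∃ y', P (i + 1) y' ∧ X.map (n0 - (i + 1 : ℕ)) (n0 - i) (by omega) y' = y := by
    intro i y hAi hP
    obtain ⟨j, hj, hAj, hmin⟩ := stab_left X fin n0 A (i + 1) hAi
    obtain ⟨z, rfl⟩ := hP j (by omega) hAj
    refine ⟨X.map (n0 - j) (n0 - (i + 1 : ℕ)) (by omega) z, fun j' hj' hA' => ?_, ?_⟩
    · exact hmin j' hj' hA' ⟨z, rfl⟩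
    · rw [X.mm]
  obtain ⟨y0, hP0, hy0⟩ := start
  let g : ∀ j : ℕ, X.space (n0 - j) := fun j => Nat.rec (motive := fun j => X.space (n0 - j)) y0
    (fun i y => if h : A (i + 1) ∧ P i y then (step i y h.1 h.2).choose else 0) j
  have gs : ∀ i, g (i + 1) =
      if h : A (i + 1) ∧ P i (g i) then (step i (g i) h.1 h.2).choose else 0 := fun i => rfl
  have gP : ∀ i, A i → P i (g i) := by
    intro i
    induction i with
    | zero => intro _; exact hP0
    | succ i ih =>
      intro hi
      have h : A (i + 1) ∧ P i (g i) := ⟨hi, ih (hA _ _ (Nat.le_succ i) hi)⟩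
      rw [gs, dif_pos h]
      exact (step i (g i) h.1 h.2).choose_spec.1
  have gmap : ∀ i, A (i + 1) →
      X.map (n0 - (i + 1 : ℕ)) (n0 - i) (by omega) (g (i + 1)) = g i := by
    intro i hi
    have h : A (i + 1) ∧ P i (g i) := ⟨hi, gP i (hA _ _ (Nat.le_succ i) hi)⟩
    rw [gs, dif_pos h]
    exact (step i (g i) h.1 h.2).choose_spec.2
  have gA : ∀ j, g j ≠ 0 → A j := by
    intro j hj
    cases j with
    | zero => exact hA0
    | succ j =>
      intro hc
      apply hj
      rw [gs, dif_neg (fun h => h.1 hc)]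
  have gmaps : ∀ j : ℕ, A j → ∀ i (h : i ≤ j),
      X.map (n0 - j) (n0 - i) (by omega) (g j) = g i := by
    intro j hj i hij
    induction j with
    | zero =>
      obtain rfl : i = 0 := by omega
      exact X.mid _ _
    | succ j ih =>
      rcases Nat.lt_or_ge j i with h | h
      · obtain rfl : i = j + 1 := by omega
        exact X.mid _ _
      · rw [← ih (hA _ _ (Nat.le_succ j) hj) h, ← gmap j hj, X.mm]
  refine ⟨g, hy0, fun j hj => gmaps j (gA j hj), fun j hj => ?_⟩
  by_contra hc
  have h1 := gmaps j hc 0 (Nat.zero_le _)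
  rw [hj, map_zero] at h1
  apply hy0
  show X.map (n0 - (0 : ℕ)) n0 (by simp) (g 0) = 0
  rw [← h1, map_zero]

theorem exists_bar_vec {k : Type} [Field k] (X : PersMod k ℤ)
    (fin : ∀ n, Module.Finite k (X.space n)) (n0 : ℤ) (v : X.space n0) (hv : v ≠ 0) :
    ∃ e : ∀ n : ℤ, X.space n, e n0 ≠ 0 ∧
      (∀ m n (h : m ≤ n), e m ≠ 0 → X.map m n h (e m) = e n) ∧
      (∀ m (h : m ≤ n0), e m = 0 → X.map m n0 h = 0) := by
  obtain ⟨g, g0, g1, g2⟩ := exists_lift_seq X fin n0 v hv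
  refine ⟨fun n => X.map (n0 - (n0 - n).toNat) n (by omega) (g (n0 - n).toNat), ?_, ?_, ?_⟩
  · have : ∀ j : ℕ, j = 0 → ∀ h, X.map (n0 - j) n0 h (g j) ≠ 0 := by
      rintro j rfl h
      exact g0
    exact this _ (by omega) _
  · intro m n h hm
    rw [X.mm]
    have hg : g (n0 - m).toNat ≠ 0 := by
      intro h0
      apply hm
      dsimp only
      rw [h0, map_zero]
    dsimp only
    rw [← g1 _ hg (n0 - n).toNat (by omega), X.mm]
  · intro m h hm
    have h0 : g (n0 - m).toNat = 0 := by
      have := congrArg (X.map m (n0 - (n0 - m).toNat) (by omega)) hm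
      rwa [X.mm, X.mid, map_zero] at this
    have := g2 _ h0
    ext z
    have h3 := LinearMap.congr_fun this (X.map m (n0 - (n0 - m).toNat) (by omega) z)
    rwa [X.mm] at h3

structure Bar {k : Type} [Field k] (X : PersMod k ℤ) where
  J : Set ℤ
  hJ : IsIntervalSet J
  e : ∀ n, X.space n
  θ : ∀ n, X.space n →ₗ[k] k
  e_off : ∀ n, n ∉ J → e n = 0
  θ_off : ∀ n, n ∉ J → θ n = 0
  pair : ∀ n, n ∈ J → θ n (e n) = 1
  e_nat : ∀ m n (h : m ≤ n), m ∈ J → X.map m n h (e m) = e n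
  θ_nat : ∀ m n (h : m ≤ n), n ∈ J → (θ n).comp (X.map m n h) = θ m

theorem exists_bar {k : Type} [Field k] (X : PersMod k ℤ)
    (fin : ∀ n, Module.Finite k (X.space n)) (n0 : ℤ) (v : X.space n0) (hv : v ≠ 0) :
    ∃ b : Bar X, n0 ∈ b.J := by
  obtain ⟨e, e0, e1, e2⟩ := exists_bar_vec X fin n0 v hv
  let J : Set ℤ := {n | e n ≠ 0}
  have hJ : IsIntervalSet J := by
    refine ⟨⟨n0, e0⟩, fun r s t hr ht hrs hst h0 => ht ?_⟩
    rw [← e1 r t (hrs.trans hst) hr, ← X.mm hrs hst, e1 r s hrs hr, h0, map_zero]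
  let N : Submodule k (∀ n, X.space n) :=
    { carrier := {y | ∃ M ∈ J, ∀ n ∈ J, M ≤ n → y n = 0}
      add_mem' := by
        rintro y z ⟨M, hM, h⟩ ⟨M', hM', h'⟩
        rcases le_total M M' with hl | hl
        · exact ⟨M', hM', fun n hn hle => by
            rw [Pi.add_apply, h n hn (hl.trans hle), h' n hn hle, add_zero]⟩
        · exact ⟨M, hM, fun n hn hle => by
            rw [Pi.add_apply, h n hn hle, h' n hn (hl.trans hle), add_zero]⟩
      zero_mem' := ⟨n0, e0, fun n _ _ => rfl⟩
      smul_mem' := by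
        rintro c y ⟨M, hM, h⟩
        exact ⟨M, hM, fun n hn hle => by rw [Pi.smul_apply, h n hn hle, smul_zero]⟩ }
  let ι : ∀ m, X.space m →ₗ[k] (∀ n, X.space n) := fun m =>
    LinearMap.pi fun n => if h : m ≤ n then X.map m n h else 0
  have ιv : ∀ m n (h : m ≤ n) y, ι m y n = X.map m n h y := by
    intro m n h y
    simp [ι, h]
  have hnot : ι n0 (e n0) ∉ N := by
    rintro ⟨M, hM, h⟩
    have hmem : max M n0 ∈ J := by
      rcases le_total M n0 with hl | hl
      · rw [max_eq_right hl]; exact e0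
      · rw [max_eq_left hl]; exact hM
    have h1 := h _ hmem (le_max_left _ _)
    rw [ιv _ _ (le_max_right _ _), e1 _ _ _ e0] at h1
    exact hmem h1
  obtain ⟨f, hf, hN⟩ := Submodule.exists_le_ker_of_notMem hnot
  let Θ : (∀ n, X.space n) →ₗ[k] k := (f (ι n0 (e n0)))⁻¹ • f
  have Θ1 : Θ (ι n0 (e n0)) = 1 := by simp [Θ, hf]
  have ΘN : ∀ y ∈ N, Θ y = 0 := by
    intro y hy
    have : f y = 0 := hN hy
    simp [Θ, this]
  have Θeq : ∀ y z, y - z ∈ N → Θ y = Θ z := by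
    intro y z h
    have := ΘN _ h
    rwa [map_sub, sub_eq_zero] at this
  refine ⟨⟨J, hJ, e, fun n => if n ∈ J then Θ.comp (ι n) else 0, ?_, ?_, ?_, ?_, ?_⟩, e0⟩
  · intro n hn
    by_contra hc
    exact hn hc
  · intro n hn
    simp only [hn, if_false]
  · intro n hn
    simp only [hn, if_true]
    rw [← Θ1]
    have hmem : max n n0 ∈ J := by
      rcases le_total n n0 with hl | hl
      · rw [max_eq_right hl]; exact e0
      · rw [max_eq_left hl]; exact hn
    refine Θeq _ _ ⟨max n n0, hmem, fun m hm hle => ?_⟩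
    rw [Pi.sub_apply, ιv _ _ ((le_max_left _ _).trans hle), ιv _ _ ((le_max_right _ _).trans hle),
      e1 _ _ _ e0, e1 _ _ _ hn, sub_self]
  · intro m n h hm
    exact e1 m n h hm
  · intro m n h hn
    ext y
    by_cases hm : m ∈ J
    · simp only [hn, hm, if_true]
      refine Θeq _ _ ⟨n, hn, fun n' hn' hle => ?_⟩
      rw [Pi.sub_apply, ιv _ _ hle, ιv _ _ (h.trans hle), X.mm, sub_self]
    · simp only [hn, hm, if_true, if_false]
      have hmn : m ≤ n0 := by
        by_contra hc
        exact hm (hJ.2 e0 hn (by omega) h)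
      have hz := e2 m hmn (by by_contra hc; exact hm hc)
      have hmem : max n n0 ∈ J := by
        rcases le_total n n0 with hl | hl
        · rw [max_eq_right hl]; exact e0
        · rw [max_eq_left hl]; exact hn
      refine ΘN _ ⟨max n n0, hmem, fun n' hn' hle => ?_⟩
      rw [ιv _ _ ((le_max_left _ _).trans hle), X.mm,
        ← X.mm hmn ((le_max_right _ _).trans hle), hz]
      simp

/-- common kernel of the functionals of a family of bars, as a persistence module -/
noncomputable def complBar {k : Type} [Field k] (X : PersMod k ℤ) (S : Set (Bar X)) :
    PersMod k ℤ where
  space n := ↥(⨅ b : S, LinearMap.ker (b.1.θ n))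
  addCommGroup := fun _ => inferInstance
  module := fun _ => inferInstance
  map m n h := LinearMap.restrict (X.map m n h)
    (p := ⨅ b : S, LinearMap.ker (b.1.θ m)) (q := ⨅ b : S, LinearMap.ker (b.1.θ n)) (by
      intro x hx
      rw [Submodule.mem_iInf] at hx ⊢
      intro b
      by_cases hn : n ∈ b.1.J
      · have := LinearMap.congr_fun (b.1.θ_nat m n h hn) x
        rw [LinearMap.mem_ker]
        exact this.trans (hx b)
      · rw [LinearMap.mem_ker, b.1.θ_off n hn]
        rfl)
  map_id n := by
    ext x
    exact X.mid _ x.1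
  map_comp r s t h1 h2 := by
    ext x
    exact X.mm _ _ x.1

def Ortho {k : Type} [Field k] {X : PersMod k ℤ} (b b' : Bar X) : Prop :=
  ∀ n, b.θ n (b'.e n) = 0

theorem bars_finite {k : Type} [Field k] (X : PersMod k ℤ)
    (fin : ∀ n, Module.Finite k (X.space n)) (S : Set (Bar X)) (hS : S.Pairwise Ortho) (n : ℤ) :
    {b | b ∈ S ∧ n ∈ b.J}.Finite := by
  have := fin n
  have li : LinearIndependent k (fun b : {b | b ∈ S ∧ n ∈ b.J} => b.1.e n) := by
    rw [linearIndependent_iff']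
    intro s g hg b hb
    have h := congrArg (b.1.θ n) hg
    rw [map_sum, map_zero, Finset.sum_eq_single b] at h
    · rw [map_smul, b.1.pair n b.2.2] at h
      simpa using h
    · intro b' _ hne
      rw [map_smul, hS b.2.1 b'.2.1 (fun h => hne (Subtype.ext h.symm)) n, smul_zero]
    · intro h'
      exact absurd hb h'
  exact Set.finite_coe_iff.mp li.finite

section Proj
variable {k : Type} [Field k] (X : PersMod k ℤ) (fin : ∀ n, Module.Finite k (X.space n))
  (S : Set (Bar X)) (hS : S.Pairwise Ortho)

noncomputable def barPi (n : ℤ) : X.space n →ₗ[k] X.space n :=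
  ∑ b ∈ (bars_finite X fin S hS n).toFinset, (b.θ n).smulRight (b.e n)

theorem barPi_eq (n : ℤ) (s : Finset (Bar X)) (hs : (bars_finite X fin S hS n).toFinset ⊆ s)
    (hsS : ∀ b ∈ s, b ∈ S) (x : X.space n) :
    barPi X fin S hS n x = ∑ b ∈ s, b.θ n x • b.e n := by
  rw [barPi, LinearMap.sum_apply]
  refine Finset.sum_subset hs fun b hb hb' => ?_
  have hn : n ∉ b.J := fun hn => hb' (by simp [hsS b hb, hn])
  simp [b.e_off n hn]

theorem theta_barPi (n : ℤ) (x : X.space n) (b : Bar X) (hb : b ∈ S) :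
    b.θ n (barPi X fin S hS n x) = b.θ n x := by
  by_cases hn : n ∈ b.J
  · rw [barPi, LinearMap.sum_apply, map_sum, Finset.sum_eq_single b]
    · simp [b.pair n hn]
    · intro b' hb' hne
      have hb'S : b' ∈ S := by
        simp at hb'
        exact hb'.1
      rw [LinearMap.smulRight_apply, map_smul, hS hb hb'S hne.symm n, smul_zero]
    · intro h
      exact absurd (by simp [hb, hn]) h
  · simp [b.θ_off n hn]

theorem barPi_nat (m n : ℤ) (h : m ≤ n) (x : X.space m) :
    X.map m n h (barPi X fin S hS m x) = barPi X fin S hS n (X.map m n h x) := by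
  have hsS : ∀ b ∈ (bars_finite X fin S hS m).toFinset ∪ (bars_finite X fin S hS n).toFinset,
      b ∈ S := by
    intro b hb
    simp at hb
    tauto
  rw [barPi_eq X fin S hS m _ Finset.subset_union_left hsS,
    barPi_eq X fin S hS n _ Finset.subset_union_right hsS, map_sum]
  refine Finset.sum_congr rfl fun b _ => ?_
  rw [map_smul]
  by_cases hm : m ∈ b.J
  · rw [b.e_nat m n h hm]
    by_cases hn : n ∈ b.J
    · rw [← b.θ_nat m n h hn]
      rfl
    · rw [b.e_off n hn, smul_zero, smul_zero]
  · rw [b.e_off m hm, map_zero, smul_zero]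
    by_cases hn : n ∈ b.J
    · have := LinearMap.congr_fun (b.θ_nat m n h hn) x
      rw [b.θ_off m hm] at this
      rw [show b.θ n (X.map m n h x) = 0 from this, zero_smul]
    · rw [b.e_off n hn, smul_zero]

noncomputable def barProj (n : ℤ) : X.space n →ₗ[k] (complBar X S).space n :=
  LinearMap.codRestrict (⨅ b : S, LinearMap.ker (b.1.θ n))
    (LinearMap.id - barPi X fin S hS n) (by
      intro x
      rw [Submodule.mem_iInf]
      intro b
      rw [LinearMap.mem_ker, LinearMap.sub_apply, map_sub, theta_barPi X fin S hS n x b.1 b.2]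
      simp)

theorem barProj_nat (m n : ℤ) (h : m ≤ n) (x : X.space m) :
    barProj X fin S hS n (X.map m n h x) = (complBar X S).map m n h (barProj X fin S hS m x) := by
  apply Subtype.ext
  show X.map m n h x - barPi X fin S hS n (X.map m n h x) =
    X.map m n h (x - barPi X fin S hS m x)
  rw [map_sub, barPi_nat]

theorem barPi_compl (n : ℤ) (x : X.space n) (hx : ∀ b ∈ S, b.θ n x = 0) :
    barPi X fin S hS n x = 0 := by
  rw [barPi, LinearMap.sum_apply]
  refine Finset.sum_eq_zero fun b hb => ?_
  simp at hb
  simp [hx b hb.1]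

theorem barProj_sub (n : ℤ) (y : (complBar X S).space n) :
    barProj X fin S hS n y.1 = y := by
  apply Subtype.ext
  show y.1 - barPi X fin S hS n y.1 = y.1
  rw [barPi_compl, sub_zero]
  intro b hb
  have := (Submodule.mem_iInf _).1 y.2 ⟨b, hb⟩
  exact this

theorem barProj_e (n : ℤ) (b : Bar X) (hb : b ∈ S) : barProj X fin S hS n (b.e n) = 0 := by
  apply Subtype.ext
  show b.e n - barPi X fin S hS n (b.e n) = 0
  by_cases hn : n ∈ b.J
  · rw [barPi, LinearMap.sum_apply, Finset.sum_eq_single b]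
    · simp [b.pair n hn]
    · intro b' hb' hne
      have hb'S : b' ∈ S := by
        simp at hb'
        exact hb'.1
      rw [LinearMap.smulRight_apply, hS hb'S hb hne n, zero_smul]
    · intro h
      exact absurd (by simp [hb, hn]) h
  · rw [b.e_off n hn, map_zero, sub_zero]

/-- a bar of the complement gives a bar of the whole module -/
noncomputable def liftBar (c : Bar (complBar X S)) : Bar X where
  J := c.J
  hJ := c.hJ
  e n := (c.e n).1
  θ n := (c.θ n).comp (barProj X fin S hS n)
  e_off n hn := by rw [c.e_off n hn]; rfl
  θ_off n hn := by rw [c.θ_off n hn]; rfl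
  pair n hn := by
    rw [LinearMap.comp_apply, barProj_sub, c.pair n hn]
  e_nat m n h hm := congrArg Subtype.val (c.e_nat m n h hm)
  θ_nat m n h hn := by
    ext x
    have := LinearMap.congr_fun (c.θ_nat m n h hn) (barProj X fin S hS m x)
    simp only [LinearMap.comp_apply] at this ⊢
    rw [barProj_nat, this]

end Proj

theorem exists_complete_family {k : Type} [Field k] (X : PersMod k ℤ)
    (fin : ∀ n, Module.Finite k (X.space n)) :
    ∃ S : Set (Bar X), S.Pairwise Ortho ∧ ∀ n (x : X.space n), (∀ b ∈ S, b.θ n x = 0) → x = 0 := by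
  obtain ⟨S, hS, hmax⟩ := zorn_subset {S : Set (Bar X) | S.Pairwise Ortho} (by
    intro c hc hchain
    refine ⟨⋃₀ c, ?_, fun s hs => Set.subset_sUnion_of_mem hs⟩
    exact (Set.pairwise_sUnion hchain.directedOn).2 fun s hs => hc hs)
  refine ⟨S, hS, fun n x hx => ?_⟩
  by_contra hne
  have finC : ∀ n, Module.Finite k ((complBar X S).space n) := by
    intro n
    have := fin n
    exact inferInstanceAs (Module.Finite k ↥(⨅ b : S, LinearMap.ker (b.1.θ n)))
  let y : (complBar X S).space n := ⟨x, (Submodule.mem_iInf _).2 fun b => hx b.1 b.2⟩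
  obtain ⟨c, hc⟩ := exists_bar (complBar X S) finC n y (fun h => hne (congrArg Subtype.val h))
  let b := liftBar X fin S hS c
  have hb1 : ∀ b' ∈ S, Ortho b' b := fun b' hb' m =>
    (Submodule.mem_iInf _).1 (c.e m).2 ⟨b', hb'⟩
  have hb2 : ∀ b' ∈ S, Ortho b b' := fun b' hb' m => by
    show c.θ m (barProj X fin S hS m (b'.e m)) = 0
    rw [barProj_e X fin S hS m b' hb', map_zero]
  have hins : (insert b S).Pairwise Ortho :=
    Set.pairwise_insert.2 ⟨hS, fun b' hb' _ => ⟨hb2 b' hb', hb1 b' hb'⟩⟩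
  have hbS : b ∈ S := hmax hins (Set.subset_insert _ _) (Set.mem_insert _ _)
  have h0 := hb1 b hbS n
  rw [b.pair n hc] at h0
  exact one_ne_zero h0

noncomputable def barTerm {k : Type} [Field k] {X : PersMod k ℤ} (b : Bar X) (n : ℤ) :
    (intervalModule k ℤ b.J b.hJ).space n →ₗ[k] X.space n where
  toFun f := if h : n ∈ b.J then (show k from f ⟨h⟩) • b.e n else 0
  map_add' f g := by
    by_cases h : n ∈ b.J
    · simp only [h, dif_pos]
      exact add_smul _ _ _
    · simp only [h, dif_neg, not_false_eq_true, add_zero]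
  map_smul' c f := by
    by_cases h : n ∈ b.J
    · simp only [h, dif_pos]
      exact mul_smul _ _ _
    · simp only [h, dif_neg, not_false_eq_true, smul_zero]

theorem barTerm_nat {k : Type} [Field k] {X : PersMod k ℤ} (b : Bar X) (m n : ℤ) (h : m ≤ n)
    (f : (intervalModule k ℤ b.J b.hJ).space m) :
    X.map m n h (barTerm b m f) = barTerm b n ((intervalModule k ℤ b.J b.hJ).map m n h f) := by
  show X.map m n h (if h : m ∈ b.J then (show k from f ⟨h⟩) • b.e m else 0) =
    if h : n ∈ b.J then (if hs : m ∈ b.J then (show k from f ⟨hs⟩) else 0) • b.e n else 0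
  by_cases hm : m ∈ b.J
  · simp only [hm, dif_pos]
    rw [map_smul, b.e_nat m n h hm]
    by_cases hn : n ∈ b.J
    · simp only [hn, dif_pos]
    · simp only [hn, dif_neg, not_false_eq_true, b.e_off n hn, smul_zero]
  · simp [hm]

theorem decomp_int {k : Type} [Field k] (X : PersMod k ℤ)
    (fin : ∀ n, Module.Finite k (X.space n)) :
    ∃ (L : Type) (J : L → Set ℤ) (hJ : ∀ ℓ, IsIntervalSet (J ℓ)),
      PersIso X (dsum fun ℓ => intervalModule k ℤ (J ℓ) (hJ ℓ)) ∧
      ∀ n, {ℓ : L | n ∈ J ℓ}.Finite := by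
  obtain ⟨S, hS, hC⟩ := exists_complete_family X fin
  refine ⟨S, fun b => b.1.J, fun b => b.1.hJ, ?_, fun n => ?_⟩
  · let D := dsum fun b : S => intervalModule k ℤ b.1.J b.1.hJ
    let F : ∀ n, D.space n →ₗ[k] X.space n := fun n =>
      DFinsupp.lsum ℕ (fun b : S => barTerm b.1 n)
    have Fs : ∀ n (b : S) f, F n (DFinsupp.single b f) = barTerm b.1 n f := by
      intro n b f
      exact DFinsupp.lsum_single _ _ _ _
    have Fθ : ∀ n (b : S) (hb : n ∈ b.1.J) (d : D.space n),
        b.1.θ n (F n d) = (show k from (show DFinsupp _ from d) b ⟨hb⟩) := by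
      intro n b hb d
      let p : D.space n →ₗ[k] k :=
        (LinearMap.proj (R := k) (φ := fun _ : PLift (n ∈ b.1.J) => k) ⟨hb⟩).comp
          (DFinsupp.lapply (R := k)
            (M := fun b : S => (intervalModule k ℤ b.1.J b.1.hJ).space n) b)
      have key : (b.1.θ n).comp (F n) = p := by
        refine DFinsupp.lhom_ext fun b' f => ?_
        refine (congrArg (b.1.θ n) (Fs n b' f)).trans ?_
        by_cases hbb : b' = b
        · subst hbb
          have h1 : (DFinsupp.single b' f :
              Π₀ b : S, (intervalModule k ℤ b.1.J b.1.hJ).space n) b' = f :=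
            DFinsupp.single_eq_same
          refine Eq.trans ?_ (congrFun h1 ⟨hb⟩).symm
          show b'.1.θ n (if h : n ∈ b'.1.J then (show k from f ⟨h⟩) • b'.1.e n else 0) = _
          rw [dif_pos hb, map_smul, b'.1.pair n hb]
          exact mul_one _
        · have h0 : b.1.θ n (b'.1.e n) = 0 :=
            hS b.2 b'.2 (fun h => hbb (Subtype.ext h.symm)) n
          have h1 : (DFinsupp.single b' f :
              Π₀ b : S, (intervalModule k ℤ b.1.J b.1.hJ).space n) b = 0 :=
            DFinsupp.single_eq_of_ne (Ne.symm hbb)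
          refine Eq.trans ?_ (congrFun h1 ⟨hb⟩).symm
          show b.1.θ n (if h : n ∈ b'.1.J then (show k from f ⟨h⟩) • b'.1.e n else 0) = (0 : k)
          split_ifs
          · rw [map_smul, h0, smul_zero]
          · rw [map_zero]
      exact LinearMap.congr_fun key d
    have Finj : ∀ n, Function.Injective (F n) := by
      intro n
      rw [injective_iff_map_eq_zero]
      intro d hd
      refine DFinsupp.ext fun b => funext fun hb => ?_
      have := Fθ n b hb.down d
      rw [hd, map_zero] at this
      exact this.symm
    have Fsurj : ∀ n, Function.Surjective (F n) := by
      intro n x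
      have hx : x = barPi X fin S hS n x := by
        rw [← sub_eq_zero]
        refine hC n _ fun b hb => ?_
        rw [map_sub, theta_barPi X fin S hS n x b hb, sub_self]
      have : barPi X fin S hS n x ∈ LinearMap.range (F n) := by
        rw [barPi, LinearMap.sum_apply]
        refine Submodule.sum_mem _ fun b hb => ?_
        simp at hb
        refine ⟨DFinsupp.single ⟨b, hb.1⟩ (fun _ => b.θ n x), ?_⟩
        refine (Fs n ⟨b, hb.1⟩ _).trans ?_
        show (if h : n ∈ b.J then (b.θ n x) • b.e n else 0) = _
        rw [dif_pos hb.2]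
        rfl
      rw [← hx] at this
      exact this
    have Fnat : ∀ m n (h : m ≤ n) (d : D.space m),
        X.map m n h (F m d) = F n (D.map m n h d) := by
      intro m n h d
      have key : (X.map m n h).comp (F m) = (F n).comp (D.map m n h) := by
        refine DFinsupp.lhom_ext fun b f => ?_
        refine (congrArg (X.map m n h) (Fs m b f)).trans ?_
        rw [barTerm_nat]
        have : D.map m n h (DFinsupp.single b f) =
            DFinsupp.single b ((intervalModule k ℤ b.1.J b.1.hJ).map m n h f) :=
          DFinsupp.mapRange_single (hf := fun i => map_zero _)
        exact ((congrArg (F n) this).trans (Fs n b _)).symm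
      exact LinearMap.congr_fun key d
    refine ⟨fun n => (LinearEquiv.ofBijective (F n) ⟨Finj n, Fsurj n⟩).symm, fun m n h => ?_⟩
    ext x
    obtain ⟨d, rfl⟩ := Fsurj m x
    have e1 : ∀ n d, (LinearEquiv.ofBijective (F n) ⟨Finj n, Fsurj n⟩).symm (F n d) = d :=
      fun n d => (LinearEquiv.ofBijective (F n) ⟨Finj n, Fsurj n⟩).symm_apply_apply d
    show (LinearEquiv.ofBijective (F n) ⟨Finj n, Fsurj n⟩).symm (X.map m n h (F m d)) =
      D.map m n h ((LinearEquiv.ofBijective (F m) ⟨Finj m, Fsurj m⟩).symm (F m d))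
    rw [e1, Fnat, e1]
  · have := bars_finite X fin S hS n
    exact Set.Finite.of_finite_image (this.subset (by rintro _ ⟨b, hb, rfl⟩; exact ⟨b.2, hb⟩))
      Subtype.val_injective.injOn

/-- the discretisation of a persistence module over the reals -/
noncomputable def discr {k : Type} [Field k] (V : PersMod k ℝ) (ε : ℝ) (hε : 0 < ε) :
    PersMod k ℤ where
  space n := LinearMap.range (V.map (n * ε) ((n + 1) * ε) (by nlinarith))
  addCommGroup := fun _ => inferInstance
  module := fun _ => inferInstance
  map m n h := LinearMap.restrict (V.map ((m + 1) * ε) ((n + 1) * ε) (by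
      have : (m : ℝ) ≤ n := by exact_mod_cast h
      nlinarith))
    (p := LinearMap.range (V.map (m * ε) ((m + 1) * ε) (by nlinarith)))
    (q := LinearMap.range (V.map (n * ε) ((n + 1) * ε) (by nlinarith)))
    (by
      have : (m : ℝ) ≤ n := by exact_mod_cast h
      rintro x ⟨y, rfl⟩
      refine ⟨V.map (m * ε) (n * ε) (by nlinarith) y, ?_⟩
      rw [V.mm, V.mm])
  map_id n := by
    ext x
    exact V.mid _ x.1
  map_comp r s t h1 h2 := by
    ext x
    exact V.mm _ _ x.1

/-- pull back along a monotone map -/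
def pullPers {k : Type} [Field k] {T T' : Type} [Preorder T] [Preorder T'] (X : PersMod k T)
    (f : T' → T) (hf : Monotone f) : PersMod k T' where
  space t := X.space (f t)
  addCommGroup := fun _ => inferInstance
  module := fun _ => inferInstance
  map s t h := X.map (f s) (f t) (hf h)
  map_id t := X.map_id _
  map_comp r s t h1 h2 := X.map_comp _ _ _ _ _

theorem floor_mono (ε : ℝ) (hε : 0 < ε) : Monotone (fun t : ℝ => ⌊t / ε⌋) := fun _ _ h =>
  Int.floor_mono (div_le_div_of_nonneg_right h hε.le)

theorem floor_b1 (ε : ℝ) (hε : 0 < ε) (t : ℝ) : (⌊t / ε⌋ : ℝ) * ε ≤ t := by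
  have := Int.floor_le (t / ε)
  rwa [le_div_iff₀ hε] at this

theorem floor_b2 (ε : ℝ) (hε : 0 < ε) (t : ℝ) : t ≤ ((⌊t / ε⌋ : ℝ) + 1) * ε := by
  have := (Int.lt_floor_add_one (t / ε)).le
  rwa [div_le_iff₀ hε] at this

theorem locFinite_pull {k : Type} [Field k] (X : PersMod k ℤ)
    (fin : ∀ n, Module.Finite k (X.space n)) (ε : ℝ) (hε : 0 < ε) :
    LocFinitePM k (pullPers X (fun t : ℝ => ⌊t / ε⌋) (floor_mono ε hε)) := by
  obtain ⟨L, J, hJ, ⟨e, he⟩, hfin⟩ := decomp_int X fin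
  have hJ' : ∀ ℓ, IsIntervalSet ((fun t : ℝ => ⌊t / ε⌋) ⁻¹' (J ℓ)) := by
    intro ℓ
    constructor
    · obtain ⟨n, hn⟩ := (hJ ℓ).1
      refine ⟨n * ε, ?_⟩
      show ⌊(n : ℝ) * ε / ε⌋ ∈ J ℓ
      rw [mul_div_cancel_right₀ _ hε.ne', Int.floor_intCast]
      exact hn
    · intro r s t hr ht hrs hst
      exact (hJ ℓ).2 hr ht (floor_mono ε hε hrs) (floor_mono ε hε hst)
  refine ⟨L, fun ℓ => (fun t : ℝ => ⌊t / ε⌋) ⁻¹' (J ℓ), hJ', ?_, ?_⟩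
  · exact ⟨fun t => e ⌊t / ε⌋, fun s t h => he _ _ _⟩
  · intro S hS
    obtain ⟨R, hR⟩ := hS.subset_closedBall 0
    have : (⋃ n ∈ Set.Icc ⌊-R / ε⌋ ⌊R / ε⌋, {ℓ : L | n ∈ J ℓ}).Finite :=
      (Set.finite_Icc _ _).biUnion fun n _ => hfin n
    refine this.subset ?_
    rintro ℓ ⟨t, ht, htS⟩
    have h1 := hR htS
    rw [Real.closedBall_eq_Icc] at h1
    simp only [Set.mem_iUnion]
    refine ⟨⌊t / ε⌋, ⟨floor_mono ε hε (by linarith [h1.1]), floor_mono ε hε (by linarith [h1.2])⟩, ht⟩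

theorem inter_discr {k : Type} [Field k] (V : PersMod k ℝ) (ε : ℝ) (hε : 0 < ε) :
    Interleaved k V (pullPers (discr V ε hε) (fun t : ℝ => ⌊t / ε⌋) (floor_mono ε hε)) ε := by
  have b1 := floor_b1 ε hε
  have b2 := floor_b2 ε hε
  have b3 : ∀ t : ℝ, t ≤ ⌊(t + ε) / ε⌋ * ε := by
    intro t
    have := b2 (t + ε)
    nlinarith
  refine ⟨fun t => (LinearMap.rangeRestrict (V.map (⌊(t + ε) / ε⌋ * ε)
      ((⌊(t + ε) / ε⌋ + 1) * ε) (by nlinarith))).comp (V.map t _ (b3 t)),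
    fun t => (V.map ((⌊t / ε⌋ + 1) * ε) (t + ε) (by nlinarith [b1 t])).comp
      (Submodule.subtype _), ?_, ?_, ?_, ?_⟩
  · intro s t h
    ext x
    apply Subtype.ext
    show V.map _ _ _ (V.map _ _ _ (V.map _ _ _ x)) = V.map _ _ _ (V.map _ _ _ (V.map _ _ _ x))
    rw [V.mm, V.mm, V.mm, V.mm]
  · intro s t h
    ext x
    show V.map _ _ _ (V.map _ _ _ x.1) = V.map _ _ _ (V.map _ _ _ x.1)
    rw [V.mm, V.mm]
  · intro t h
    ext x
    show V.map _ _ _ (V.map _ _ _ (V.map _ _ _ x)) = V.map _ _ _ x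
    rw [V.mm, V.mm]
  · intro t h
    ext x
    apply Subtype.ext
    show V.map _ _ _ (V.map _ _ _ (V.map _ _ _ x.1)) = V.map _ _ _ x.1
    rw [V.mm, V.mm]

theorem locFinite_finite {k : Type} [Field k] (W : PersMod k ℝ) (hW : LocFinitePM k W) (t : ℝ) :
    Module.Finite k (W.space t) := by
  obtain ⟨L, J, hJ, ⟨e, he⟩, hfin⟩ := hW
  have hf : {ℓ : L | t ∈ J ℓ}.Finite := by
    refine (hfin {t} Bornology.isBounded_singleton).subset fun ℓ hℓ => ⟨t, hℓ, rfl⟩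
  have := hf.to_subtype
  let p : (dsum fun ℓ => intervalModule k ℝ (J ℓ) (hJ ℓ)).space t →ₗ[k]
      ({ℓ : L | t ∈ J ℓ} → k) :=
    LinearMap.pi fun ℓ => (LinearMap.proj (R := k) (φ := fun _ : PLift (t ∈ J ℓ.1) => k)
      ⟨ℓ.2⟩).comp (DFinsupp.lapply (R := k)
            (M := fun ℓ : L => (intervalModule k ℝ (J ℓ) (hJ ℓ)).space t) ℓ.1)
  have hp : Function.Injective (p.comp (e t).toLinearMap) := by
    have : Function.Injective p := by
      rw [injective_iff_map_eq_zero]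
      intro d hd
      refine DFinsupp.ext fun ℓ => funext fun hb => ?_
      exact congrFun hd ⟨ℓ, hb.down⟩
    exact this.comp (e t).injective
  exact Module.Finite.of_injective _ hp

theorem stmt18 {k : Type} [Field k] (V : PersMod k ℝ) :
    QTame k V ↔
      ∀ ε : ℝ, 0 < ε → ∃ W : PersMod k ℝ, LocFinitePM k W ∧ Interleaved k V W ε := by
  constructor
  · intro hV ε hε
    refine ⟨_, locFinite_pull (discr V ε hε) (fun n => ?_) ε hε, inter_discr V ε hε⟩
    have h := hV (n * ε) ((n + 1) * ε) (by nlinarith)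
    exact Module.rank_lt_aleph0_iff.1 (Cardinal.toENat_ne_top.1 h)
  · intro H s t hst
    have hε : 0 < (t - s) / 2 := by linarith
    obtain ⟨W, hW, φ, ψ, -, -, h, -⟩ := H _ hε
    have hfin := locFinite_finite W hW (s + (t - s) / 2)
    have hfac : V.map s t hst.le = ((V.map (s + (t - s) / 2 + (t - s) / 2) t (by linarith)).comp
        (ψ (s + (t - s) / 2))).comp (φ s) := by
      rw [LinearMap.comp_assoc, h s (by linarith), V.map_comp]
    apply Cardinal.toENat_ne_top.2
    apply Module.rank_lt_aleph0_iff.2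
    rw [hfac]
    exact Module.Finite.of_injective (Submodule.inclusion (LinearMap.range_comp_le_range _ _))
      (Submodule.inclusion_injective _)
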